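/- arXiv:1002.4059 — 2 statements merged into one kernel-verified Lean document; each statement's English description precedes it below -/
import Mathlib

section
/- Fix positive constants r, L, R and α with 0 < α < 1. There exists a constant C₄ > 0, depending on r, L, R and α only, such that for any two bounded open sets Ω₁, Ω₂ ⊂ B_R which are of class C^{1,α} with constants r and L, one has |ℋ¹(∂Ω₁) − ℋ¹(∂Ω₂)| ≤ C₄ (d_H(∂Ω₁, ∂Ω₂))^{α/(2α+2)}. -/
open MeasureTheory Metric Set

noncomputable section

abbrev E2 : Type := EuclideanSpace ℝ (Fin 2)

/-- A bounded open set `Ω ⊆ ℝ²` is of class `C^{1,α}` with constants `r` and `L`: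
at every boundary point, after a rigid change of coordinates taking the point to the origin,
`Ω` coincides in the ball of radius `r` with the subgraph of a `C^{1,α}` function `φ`
with `C^{1,α}` norm bounded by `L` and `φ 0 = 0`. -/
def IsC1alphaDomain (r L α : ℝ) (Ω : Set E2) : Prop :=
  ∀ x ∈ frontier Ω, ∃ (A : E2 ≃ᵢ E2) (φ : ℝ → ℝ),
    A x = 0 ∧ ContDiff ℝ 1 φ ∧ φ 0 = 0 ∧
    (∀ t, |φ t| ≤ L) ∧ (∀ t, |deriv φ t| ≤ L) ∧
    (∀ t₁ t₂, |deriv φ t₁ - deriv φ t₂| ≤ L * |t₁ - t₂| ^ α) ∧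
    ∀ y ∈ ball x r, (y ∈ Ω ↔ (A y) 1 < φ ((A y) 0))

lemma phi_mvt (φ : ℝ → ℝ) (hφ : ContDiff ℝ 1 φ) (L α ρ : ℝ) (hL : 0 < L) (hα : 0 < α)
    (hH : ∀ t₁ t₂, |deriv φ t₁ - deriv φ t₂| ≤ L * |t₁ - t₂| ^ α)
    (a b : ℝ) (ha : |a| ≤ ρ) (hb : |b| ≤ ρ) :
    |(φ a - φ b) - deriv φ 0 * (a - b)| ≤ L * ρ ^ α * |a - b| := by
  have hd : Differentiable ℝ φ := hφ.differentiable (by norm_num)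
  have key := Convex.norm_image_sub_le_of_norm_hasDerivWithin_le (𝕜 := ℝ)
    (f := fun t => φ t - deriv φ 0 * t) (f' := fun t => deriv φ t - deriv φ 0)
    (C := L * ρ ^ α) (s := Icc (-ρ) ρ) (x := b) (y := a) ?_ ?_ (convex_Icc _ _)
    (abs_le.1 hb) (abs_le.1 ha)
  · simp only [Real.norm_eq_abs] at key
    convert key using 2
    ring
  · intro t _
    have h1 := (hd t).hasDerivAt.sub ((hasDerivAt_id t).const_mul (deriv φ 0))
    simp only [mul_one] at h1
    exact h1.hasDerivWithinAt
  · intro t ht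
    have h1 := hH t 0
    rw [sub_zero] at h1
    rw [Real.norm_eq_abs]
    refine h1.trans ?_
    gcongr
    exact abs_le.2 ht

lemma frontier_iff (r : ℝ) (Ω : Set E2) (hΩ : IsOpen Ω) (x : E2) (A : E2 ≃ᵢ E2) (φ : ℝ → ℝ)
    (hφ : Continuous φ)
    (h : ∀ y ∈ ball x r, (y ∈ Ω ↔ (A y) 1 < φ ((A y) 0))) (y : E2) (hy : y ∈ ball x r) :
    y ∈ frontier Ω ↔ (A y) 1 = φ ((A y) 0) := by
  have hA := A.continuous
  have hc0 : Continuous fun y => (A y) 0 := (EuclideanSpace.proj (𝕜 := ℝ) (0 : Fin 2)).continuous.comp hA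
  have hc1 : Continuous fun y => (A y) 1 := (EuclideanSpace.proj (𝕜 := ℝ) (1 : Fin 2)).continuous.comp hA
  rw [hΩ.frontier_eq]
  constructor
  · rintro ⟨hcl, hn⟩
    rw [h y hy, not_lt] at hn
    refine le_antisymm ?_ hn
    by_contra! hlt
    have hU : IsOpen (ball x r ∩ {z | φ ((A z) 0) < (A z) 1}) :=
      isOpen_ball.inter (isOpen_lt (hφ.comp hc0) hc1)
    obtain ⟨z, ⟨hz1, hz2⟩, hz3⟩ := mem_closure_iff.1 hcl _ hU ⟨hy, hlt⟩
    exact absurd ((h z hz1).1 hz3) (not_lt.2 (le_of_lt hz2))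
  · intro he
    refine ⟨?_, by rw [h y hy, he]; exact lt_irrefl _⟩
    let c : ℝ → E2 := fun e => A.symm (A y - e • EuclideanSpace.single (1 : Fin 2) (1 : ℝ))
    have hc : Continuous c := A.symm.continuous.comp (by fun_prop)
    have hc00 : c 0 = y := by simp [c]
    have ht : Filter.Tendsto c (nhdsWithin 0 (Ioi 0)) (nhds y) := by
      have := hc.tendsto 0
      rw [hc00] at this
      exact this.mono_left nhdsWithin_le_nhds
    refine mem_closure_of_tendsto ht ?_
    filter_upwards [ht (isOpen_ball.mem_nhds hy), self_mem_nhdsWithin] with e h1 h2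
    rw [h _ h1]
    simp only [c, IsometryEquiv.apply_symm_apply]
    have h2' : 0 < e := h2
    simp [he, h2']

set_option maxHeartbeats 2000000 in
lemma density (r L α : ℝ) (hL : 0 < L) (hα : 0 < α) (Ω : Set E2) (hΩ : IsOpen Ω)
    (hC : IsC1alphaDomain r L α Ω) (x : E2) (hx : x ∈ frontier Ω) (ρ : ℝ) (hρ : 0 < ρ)
    (hρr : ρ ≤ r) (hρ1 : L * ρ ^ α ≤ 1) :
    μH[1] (frontier Ω ∩ ball x ρ) ≤ ENNReal.ofReal (2 * ρ * (1 + 3 * (L * ρ ^ α))) ∧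
    ENNReal.ofReal (2 * ρ * (1 - 2 * (L * ρ ^ α))) ≤ μH[1] (frontier Ω ∩ ball x ρ) := by
  obtain ⟨A, φ, hA, hφ, hφ0, -, -, hH, hΩφ⟩ := hC x hx
  have hmvt := phi_mvt φ hφ L α ρ hL hα hH
  have hfr := fun y hy => frontier_iff r Ω hΩ x A φ hφ.continuous hΩφ y hy
  have hε : 0 < L * ρ ^ α := by positivity
  generalize L * ρ ^ α = ε at hmvt hρ1 hε ⊢
  generalize hm : deriv φ 0 = m at hmvt
  obtain ⟨s, hs0, hs2⟩ : ∃ s : ℝ, 0 < s ∧ s ^ 2 = 1 + m ^ 2 :=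
    ⟨√(1 + m ^ 2), by positivity, Real.sq_sqrt (by positivity)⟩
  have hs1 : 1 ≤ s := by nlinarith
  have hms : |m| ≤ s := abs_le_of_sq_le_sq (by nlinarith) hs0.le
  have hnorm : ∀ y, ‖A y‖ = dist y x := fun y => by
    rw [← dist_zero_right, ← hA, A.dist_eq]
  let g : ℝ → E2 := fun t => !₂[t, φ t]
  have hφt : ∀ t, |t| ≤ ρ → |φ t - m * t| ≤ ε * |t| := fun t ht => by
    simpa [hφ0] using hmvt t 0 ht (by simpa using hρ.le)
  have hgn : ∀ t, ‖g t‖ ^ 2 = t ^ 2 + φ t ^ 2 := fun t => by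
    simp [EuclideanSpace.norm_sq_eq, g, Fin.sum_univ_two]
  constructor
  · -- upper bound
    set c := min ρ (ρ * (1 + ε) / s) with hcdef
    have hc0 : 0 ≤ c := by positivity
    have hlip : LipschitzOnWith (Real.toNNReal (s + ε)) (fun t => A.symm (g t)) (Icc (-c) c) := by
      refine LipschitzOnWith.of_dist_le_mul fun t ht t' ht' => ?_
      rw [A.symm.dist_eq, Real.coe_toNNReal _ (by positivity), EuclideanSpace.dist_eq]
      refine Real.sqrt_le_iff.2 ⟨by positivity, ?_⟩
      have h1 := hmvt t t' ((abs_le.2 ht).trans (min_le_left _ _))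
        ((abs_le.2 ht').trans (min_le_left _ _))
      have h2 : |φ t - φ t'| ≤ (|m| + ε) * |t - t'| := by
        have := abs_add_le (φ t - φ t' - m * (t - t')) (m * (t - t'))
        rw [abs_mul, sub_add_cancel] at this
        linarith
      have h3 : |φ t - φ t'| ^ 2 ≤ ((|m| + ε) * |t - t'|) ^ 2 := by gcongr
      simp only [g, Fin.sum_univ_two, Real.dist_eq]
      simp
      rw [sq_abs] at h3
      rw [mul_pow, sq_abs] at h3 ⊢
      have h4 : 1 + (|m| + ε) ^ 2 ≤ (s + ε) ^ 2 := by nlinarith [sq_abs m]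
      nlinarith [sq_nonneg (t - t')]
    have hsub : frontier Ω ∩ ball x ρ ⊆ (fun t => A.symm (g t)) '' Icc (-c) c := by
      rintro y ⟨hy1, hy2⟩
      have he := (hfr y (ball_subset_ball hρr hy2)).1 hy1
      have hg : g ((A y) 0) = A y := by
        ext i; fin_cases i <;> simp [g, he]
      refine ⟨(A y) 0, abs_le.1 ?_, by simp [hg]⟩
      have hn : ‖g ((A y) 0)‖ < ρ := by rw [hg, hnorm]; exact hy2
      generalize (A y) 0 = t at hn
      have h1 : t ^ 2 + φ t ^ 2 < ρ ^ 2 := by rw [← hgn]; gcongr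
      have ht : |t| ≤ ρ := abs_le_of_sq_le_sq (by nlinarith [sq_nonneg (φ t)]) hρ.le
      refine le_min ht ?_
      rw [le_div_iff₀ hs0]
      -- s|t| ≤ ρ + ε|t|
      have h2 := hφt t ht
      have h3 : s * |t| ≤ ρ + ε * |t| := by
        -- s² t = t + mφ - m(φ - m t)
        have h4 : s ^ 2 * t = (t + m * φ t) - m * (φ t - m * t) := by rw [hs2]; ring
        have h5 : |t + m * φ t| ≤ s * ρ := by
          refine abs_le_of_sq_le_sq ?_ (by positivity)
          rw [mul_pow, hs2]
          nlinarith [sq_nonneg (φ t - m * t), sq_nonneg m]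
        have h6 : |s ^ 2 * t| ≤ s * ρ + s * (ε * |t|) := by
          rw [h4]
          refine (abs_sub _ _).trans ?_
          rw [abs_mul]
          gcongr
        rw [abs_mul, abs_of_pos (by positivity : 0 < s ^ 2)] at h6
        have : s * (s * |t|) ≤ s * (ρ + ε * |t|) := by nlinarith
        exact le_of_mul_le_mul_left this hs0
      nlinarith
    calc μH[1] (frontier Ω ∩ ball x ρ) ≤ μH[1] ((fun t => A.symm (g t)) '' Icc (-c) c) :=
          measure_mono hsub
      _ ≤ (Real.toNNReal (s + ε) : ENNReal) ^ (1 : ℝ) * μH[1] (Icc (-c) c) :=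
          hlip.hausdorffMeasure_image_le zero_le_one
      _ = ENNReal.ofReal ((s + ε) * (c - -c)) := by
          rw [hausdorffMeasure_real, Real.volume_Icc, ENNReal.rpow_one,
            ENNReal.ofReal_mul (by positivity)]; rfl
      _ ≤ _ := by
          apply ENNReal.ofReal_le_ofReal
          have h1 : c * s ≤ ρ * (1 + ε) := by
            rw [← le_div_iff₀ hs0]; exact min_le_right _ _
          have h2 : c ≤ c * s := by nlinarith
          have h3 : ε * c ≤ ε * (ρ * (1 + ε)) := by gcongr; linarith
          nlinarith [mul_pos hρ hε]
  · -- lower bound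
    set a := ρ * (1 - ε) / s with hadef
    have has : a * s = ρ * (1 - ε) := by rw [hadef]; field_simp
    have ha0 : 0 ≤ a := div_nonneg (mul_nonneg hρ.le (by linarith)) hs0.le
    have ha1 : a ≤ ρ * (1 - ε) := by nlinarith
    have ha2 : a ≤ ρ := by nlinarith
    let u : E2 → ℝ := fun y => ((A y) 0 + m * (A y) 1) / s
    let w : ℝ → ℝ := fun t => (t + m * φ t) / s
    have hu : LipschitzWith 1 u := by
      refine LipschitzWith.of_dist_le_mul fun y z => ?_
      rw [NNReal.coe_one, one_mul, ← A.dist_eq y z, EuclideanSpace.dist_eq, Real.dist_eq]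
      refine Real.abs_le_sqrt ?_
      simp only [u, Fin.sum_univ_two, Real.dist_eq, sq_abs]
      rw [← sub_div, div_pow, div_le_iff₀ (by positivity), hs2]
      nlinarith [sq_nonneg ((A y) 1 - (A z) 1 - m * ((A y) 0 - (A z) 0))]
    have hw : Continuous w := by
      have := hφ.continuous
      fun_prop
    have hsub : Icc (w (-a)) (w a) ⊆ u '' (frontier Ω ∩ ball x ρ) := by
      intro v hv
      obtain ⟨t, ht, rfl⟩ := intermediate_value_Icc (by linarith : -a ≤ a) hw.continuousOn hv
      have ht' := abs_le.2 ht
      have hb : A.symm (g t) ∈ ball x ρ := by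
        rw [mem_ball, ← hnorm, A.apply_symm_apply]
        refine lt_of_pow_lt_pow_left₀ 2 hρ.le ?_
        rw [hgn]
        have h2 := hφt t (ht'.trans ha2)
        have h3 : t ^ 2 + φ t ^ 2 ≤ ((s + ε) * |t|) ^ 2 := by
          have h2' : |φ t| ≤ (|m| + ε) * |t| := by
            have := abs_add_le (φ t - m * t) (m * t)
            rw [abs_mul, sub_add_cancel] at this
            linarith
          have h3 : |φ t| ^ 2 ≤ ((|m| + ε) * |t|) ^ 2 := by gcongr
          rw [sq_abs] at h3
          rw [mul_pow, sq_abs] at h3 ⊢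
          have h4 : 1 + (|m| + ε) ^ 2 ≤ (s + ε) ^ 2 := by nlinarith [sq_abs m]
          nlinarith [sq_nonneg t]
        refine h3.trans_lt ?_
        have h5 : (s + ε) * |t| < ρ := by
          calc (s + ε) * |t| ≤ (s + ε) * a := by gcongr
            _ < ρ := by nlinarith [mul_pos hρ (mul_pos hε hε)]
        gcongr
      refine ⟨A.symm (g t), ⟨?_, hb⟩, ?_⟩
      · rw [hfr _ (ball_subset_ball hρr hb)]
        simp [g]
      · simp [u, w, g]
    have hlen : 2 * ρ * (1 - 2 * ε) ≤ w a - w (-a) := by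
      have h1 := abs_le.1 (hmvt a (-a) (by rwa [abs_of_nonneg ha0]) (by rwa [abs_neg, abs_of_nonneg ha0]))
      have h2 : |m * ((φ a - φ (-a)) - m * (a - -a))| ≤ s * (ε * (2 * a)) := by
        rw [abs_mul]
        have h := hmvt a (-a) (by rwa [abs_of_nonneg ha0]) (by rwa [abs_neg, abs_of_nonneg ha0])
        rw [show |a - -a| = 2 * a by rw [abs_of_nonneg (by linarith)]; ring] at h
        gcongr
      have h3 := (abs_le.1 h2).1
      have h4 : w a - w (-a) = (s ^ 2 * (2 * a) + m * ((φ a - φ (-a)) - m * (a - -a))) / s := by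
        simp only [w]; rw [hs2]; ring
      rw [h4, le_div_iff₀ hs0]
      have h5 : s * (s * (2 * a) - ε * (2 * a)) ≥ s * (2 * ρ * (1 - 2 * ε)) := by
        apply mul_le_mul_of_nonneg_left _ hs0.le
        nlinarith [mul_pos hρ (mul_pos hε hε), mul_le_mul_of_nonneg_left ha1 hε.le]
      nlinarith
    calc ENNReal.ofReal (2 * ρ * (1 - 2 * ε)) ≤ ENNReal.ofReal (w a - w (-a)) :=
          ENNReal.ofReal_le_ofReal hlen
      _ = μH[1] (Icc (w (-a)) (w a)) := by rw [hausdorffMeasure_real, Real.volume_Icc]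
      _ ≤ μH[1] (u '' (frontier Ω ∩ ball x ρ)) := measure_mono hsub
      _ ≤ ((1 : NNReal) : ENNReal) ^ (1 : ℝ) * μH[1] (frontier Ω ∩ ball x ρ) :=
          hu.hausdorffMeasure_image_le zero_le_one _
      _ = _ := by simp

lemma density_near (r L α : ℝ) (hL : 0 < L) (hα : 0 < α) (hα1 : α < 1) (Ω : Set E2)
    (hΩ : IsOpen Ω) (hC : IsC1alphaDomain r L α Ω) (ρ d : ℝ) (hρ : 0 < ρ) (hd0 : 0 < d)
    (hd : d ≤ 2 * ρ ^ 2) (hρ4 : ρ ≤ 1 / 4) (hρr : 2 * ρ ≤ r) (hρ1 : L * (2 * ρ) ^ α ≤ 1)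
    (y : E2) (hy : ∃ x ∈ frontier Ω, dist y x < d) :
    μH[1] (frontier Ω ∩ ball y ρ) ≤ ENNReal.ofReal (2 * ρ * (1 + (8 + 6 * L) * ρ ^ α)) ∧
    ENNReal.ofReal (2 * ρ * (1 - (8 + 6 * L) * ρ ^ α)) ≤ μH[1] (frontier Ω ∩ ball y ρ) := by
  obtain ⟨x, hx, hyx⟩ := hy
  have hdρ : d ≤ ρ / 2 := by nlinarith
  have hρα : ρ ≤ ρ ^ α := by
    conv_lhs => rw [← Real.rpow_one ρ]
    exact Real.rpow_le_rpow_of_exponent_ge hρ (by linarith) hα1.le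
  have h2α : (2 * ρ) ^ α ≤ 2 * ρ ^ α := by
    rw [Real.mul_rpow (by norm_num) hρ.le]
    gcongr
    conv_rhs => rw [← Real.rpow_one 2]
    exact Real.rpow_le_rpow_of_exponent_le (by norm_num) hα1.le
  have hpos : 0 < ρ ^ α := by positivity
  constructor
  · have hm : (ρ + d) ^ α ≤ (2 * ρ) ^ α := by
      apply Real.rpow_le_rpow <;> linarith
    have hLm : L * (ρ + d) ^ α ≤ L * (2 * ρ) ^ α := by gcongr
    have h := (density r L α hL hα Ω hΩ hC x hx (ρ + d) (by linarith) (by linarith)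
      (hLm.trans hρ1)).1
    refine (measure_mono (inter_subset_inter_right _ (ball_subset_ball' ?_))).trans (h.trans ?_)
    · linarith
    · apply ENNReal.ofReal_le_ofReal
      have h1 : 2 * (ρ + d) * (1 + 3 * (L * (ρ + d) ^ α)) ≤
        2 * (ρ * (1 + 2 * ρ)) * (1 + 3 * (L * (2 * ρ) ^ α)) := by
        gcongr
        nlinarith
      refine h1.trans ?_
      have h2 : (1 + 2 * ρ) * (1 + 3 * (L * (2 * ρ) ^ α)) ≤ 1 + (8 + 6 * L) * ρ ^ α := by
        have h3 : L * (2 * ρ) ^ α ≤ L * (2 * ρ ^ α) := by gcongr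
        nlinarith
      nlinarith
  · have hm : (ρ - d) ^ α ≤ ρ ^ α := by
      apply Real.rpow_le_rpow <;> linarith
    have hm' : ρ ^ α ≤ (2 * ρ) ^ α := by
      apply Real.rpow_le_rpow <;> linarith
    have hLm : L * (ρ - d) ^ α ≤ L * ρ ^ α := by gcongr
    have hLm' : L * ρ ^ α ≤ L * (2 * ρ) ^ α := by gcongr
    have h := (density r L α hL hα Ω hΩ hC x hx (ρ - d) (by linarith) (by linarith)
      ((hLm.trans hLm').trans hρ1)).2
    refine le_trans (ENNReal.ofReal_le_ofReal ?_)
      (h.trans (measure_mono (inter_subset_inter_right _ (ball_subset_ball' ?_))))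
    · have h0 : 0 ≤ (ρ - d) ^ α := Real.rpow_nonneg (by linarith) _
      have e1 : (ρ - d) * (L * (ρ - d) ^ α) ≤ ρ * (L * ρ ^ α) := by
        apply mul_le_mul _ hLm (by positivity) hρ.le
        linarith
      have e2 : d ≤ 2 * (ρ * ρ ^ α) := by nlinarith
      have e3 : 0 < ρ * (L * ρ ^ α) := by positivity
      have e4 : 0 < ρ * ρ ^ α := by positivity
      nlinarith
    · rw [dist_comm] at hyx; linarith

lemma perim_bound (r L R α : ℝ) (hr : 0 < r) (hL : 0 < L) (hα : 0 < α) :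
    ∃ M : ℝ, 0 < M ∧ ∀ Ω : Set E2, IsOpen Ω → Ω ⊆ ball (0 : E2) R → IsC1alphaDomain r L α Ω →
      μH[1] (frontier Ω) ≤ ENNReal.ofReal M := by
  obtain ⟨ρ, hρ, hρr, hρ1⟩ : ∃ ρ : ℝ, 0 < ρ ∧ ρ ≤ r ∧ L * ρ ^ α ≤ 1 := by
    refine ⟨min r ((1 / L) ^ (1 / α)), by positivity, min_le_left _ _, ?_⟩
    have : (min r ((1 / L) ^ (1 / α))) ^ α ≤ ((1 / L) ^ (1 / α)) ^ α :=
      Real.rpow_le_rpow (by positivity) (min_le_right _ _) hα.le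
    rw [← Real.rpow_mul (by positivity), one_div_mul_cancel hα.ne', Real.rpow_one] at this
    calc _ ≤ L * (1 / L) := by gcongr
      _ = 1 := by field_simp
  obtain ⟨t, -, htf, htc⟩ := (isCompact_closedBall (0 : E2) R).finite_cover_balls
    (half_pos hρ)
  lift t to Finset E2 using htf
  refine ⟨t.card * (8 * ρ) + 1, by positivity, fun Ω hΩ hΩR hC => ?_⟩
  have hfR : frontier Ω ⊆ closedBall 0 R :=
    frontier_subset_closure.trans (closure_minimal (hΩR.trans ball_subset_closedBall) isClosed_closedBall)
  have hcov : frontier Ω ⊆ ⋃ p ∈ t, (frontier Ω ∩ ball p (ρ / 2)) := by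
    intro y hy
    have := htc (hfR hy)
    simp only [mem_iUnion, exists_prop, Finset.mem_coe] at this
    obtain ⟨p, hp, hyp⟩ := this
    exact mem_biUnion hp ⟨hy, hyp⟩
  calc μH[1] (frontier Ω) ≤ _ := measure_mono hcov
    _ ≤ ∑ p ∈ t, μH[1] (frontier Ω ∩ ball p (ρ / 2)) := measure_biUnion_finset_le _ _
    _ ≤ ∑ p ∈ t, ENNReal.ofReal (8 * ρ) := by
        refine Finset.sum_le_sum fun p _ => ?_
        rcases (frontier Ω ∩ ball p (ρ / 2)).eq_empty_or_nonempty with h | ⟨z, hz1, hz2⟩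
        · rw [h]; simp
        · refine (measure_mono (inter_subset_inter_right _ (ball_subset_ball' ?_))).trans
            ((density r L α hL hα Ω hΩ hC z hz1 ρ hρ hρr hρ1).1.trans
              (ENNReal.ofReal_le_ofReal ?_))
          · rw [mem_ball, dist_comm] at hz2; linarith
          · nlinarith
    _ = ENNReal.ofReal (t.card * (8 * ρ)) := by
        rw [Finset.sum_const, nsmul_eq_mul, ENNReal.ofReal_mul (by positivity)]; simp
    _ ≤ _ := ENNReal.ofReal_le_ofReal (by linarith)

lemma double_count (S T : Set E2) (hS : IsClosed S) (hT : IsClosed T) (hSf : μH[1] S ≠ ⊤)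
    (hTf : μH[1] T ≠ ⊤) (ρ a b : ℝ) (ha : 0 ≤ a) (hb : 0 ≤ b)
    (h1 : ∀ x ∈ S, ENNReal.ofReal a ≤ μH[1] (T ∩ ball x ρ))
    (h2 : ∀ y ∈ T, μH[1] (S ∩ ball y ρ) ≤ ENNReal.ofReal b) :
    a * (μH[1] S).toReal ≤ b * (μH[1] T).toReal := by
  have i1 : IsFiniteMeasure ((μH[1] : Measure E2).restrict S) :=
    ⟨by rw [Measure.restrict_apply_univ]; exact hSf.lt_top⟩
  have i2 : IsFiniteMeasure ((μH[1] : Measure E2).restrict T) :=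
    ⟨by rw [Measure.restrict_apply_univ]; exact hTf.lt_top⟩
  have hm : MeasurableSet {p : E2 × E2 | dist p.1 p.2 < ρ} :=
    (isOpen_lt (by fun_prop) (by fun_prop)).measurableSet
  have e1 := Measure.prod_apply (μ := (μH[1] : Measure E2).restrict S)
    (ν := (μH[1] : Measure E2).restrict T) hm
  have e2 := Measure.prod_apply_symm (μ := (μH[1] : Measure E2).restrict S)
    (ν := (μH[1] : Measure E2).restrict T) hm
  have l1 : ENNReal.ofReal a * μH[1] S ≤ ∫⁻ x in S, ((μH[1] : Measure E2).restrict T)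
      (Prod.mk x ⁻¹' {p : E2 × E2 | dist p.1 p.2 < ρ}) ∂μH[1] := by
    rw [← setLIntegral_const]
    refine setLIntegral_mono' hS.measurableSet fun x hx => (h1 x hx).trans (le_of_eq ?_)
    have : Prod.mk x ⁻¹' {p : E2 × E2 | dist p.1 p.2 < ρ} = ball x ρ := by
      ext z; simp [dist_comm]
    rw [this, Measure.restrict_apply measurableSet_ball, inter_comm]
  have l2 : ∫⁻ y in T, ((μH[1] : Measure E2).restrict S)
      ((fun x => (x, y)) ⁻¹' {p : E2 × E2 | dist p.1 p.2 < ρ}) ∂μH[1] ≤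
      ENNReal.ofReal b * μH[1] T := by
    rw [← setLIntegral_const]
    refine setLIntegral_mono' hT.measurableSet fun y hy => (le_of_eq ?_).trans (h2 y hy)
    have : (fun x => (x, y)) ⁻¹' {p : E2 × E2 | dist p.1 p.2 < ρ} = ball y ρ := by
      ext z; simp
    rw [this, Measure.restrict_apply measurableSet_ball, inter_comm]
  rw [← e1] at l1
  rw [← e2] at l2
  have := ENNReal.toReal_mono (ENNReal.mul_ne_top ENNReal.ofReal_ne_top hTf) (l1.trans l2)
  rwa [ENNReal.toReal_mul, ENNReal.toReal_mul, ENNReal.toReal_ofReal ha,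
    ENNReal.toReal_ofReal hb] at this

lemma frontier_ok (R : ℝ) (Ω : Set E2) (hne : Ω.Nonempty) (hR : Ω ⊆ ball (0 : E2) R) :
    (frontier Ω).Nonempty ∧ Bornology.IsBounded (frontier Ω) := by
  constructor
  · rw [nonempty_frontier_iff]
    refine ⟨hne, fun h => ?_⟩
    have : Bornology.IsBounded (univ : Set E2) := by
      rw [← h]; exact isBounded_ball.subset hR
    exact NormedSpace.unbounded_univ ℝ E2 this
  · exact isBounded_closedBall.subset (frontier_subset_closure.trans
      (closure_minimal (hR.trans ball_subset_closedBall) isClosed_closedBall))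

theorem stmt10 (r L R α : ℝ) (hr : 0 < r) (hL : 0 < L) (hR : 0 < R)
    (hα : 0 < α) (hα1 : α < 1) :
    ∃ C₄ : ℝ, 0 < C₄ ∧
      ∀ Ω₁ Ω₂ : Set E2, IsOpen Ω₁ → IsOpen Ω₂ → Ω₁.Nonempty → Ω₂.Nonempty →
        Ω₁ ⊆ ball (0 : E2) R → Ω₂ ⊆ ball (0 : E2) R →
        IsC1alphaDomain r L α Ω₁ → IsC1alphaDomain r L α Ω₂ →
        |(μH[1] (frontier Ω₁)).toReal - (μH[1] (frontier Ω₂)).toReal| ≤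
          C₄ * hausdorffDist (frontier Ω₁) (frontier Ω₂) ^ (α / (2 * α + 2)) := by
  obtain ⟨M, hM, hMb⟩ := perim_bound r L R α hr hL hα
  set K := 8 + 6 * L with hK
  have hK0 : 0 < K := by positivity
  set β := α / (2 * α + 2) with hβ
  have hβ0 : 0 < β := by positivity
  have hβα : β ≤ α / 2 := by
    rw [hβ]; gcongr; linarith
  -- threshold for ρ
  obtain ⟨ρ₀, hρ₀, hA, hB, hC, hD⟩ : ∃ ρ₀ : ℝ, 0 < ρ₀ ∧ ρ₀ ≤ 1 / 4 ∧ 2 * ρ₀ ≤ r ∧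
      L * (2 * ρ₀) ^ α ≤ 1 ∧ K * ρ₀ ^ α ≤ 1 := by
    have c1 : Filter.Tendsto (fun ρ : ℝ => L * (2 * ρ) ^ α) (nhdsWithin 0 (Ioi 0)) (nhds 0) := by
      have : Continuous (fun ρ : ℝ => L * (2 * ρ) ^ α) := by
        have := Real.continuous_rpow_const hα.le
        exact continuous_const.mul (this.comp (continuous_const.mul continuous_id))
      have h := this.tendsto 0
      rw [mul_zero, Real.zero_rpow hα.ne', mul_zero] at h
      exact h.mono_left nhdsWithin_le_nhds
    have c2 : Filter.Tendsto (fun ρ : ℝ => K * ρ ^ α) (nhdsWithin 0 (Ioi 0)) (nhds 0) := by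
      have this : Continuous (fun ρ : ℝ => K * ρ ^ α) :=
        continuous_const.mul (Real.continuous_rpow_const hα.le)
      have h := this.tendsto 0
      rw [Real.zero_rpow hα.ne', mul_zero] at h
      exact h.mono_left nhdsWithin_le_nhds
    have c3 : ∀ᶠ ρ : ℝ in nhdsWithin 0 (Ioi 0), ρ < min (1 / 4) (r / 2) :=
      nhdsWithin_le_nhds (Iio_mem_nhds (by positivity))
    obtain ⟨ρ, h1, h2, h3, h4⟩ := ((c1.eventually (ge_mem_nhds one_pos)).and
      ((c2.eventually (ge_mem_nhds one_pos)).and (c3.and self_mem_nhdsWithin))).exists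
    have h5 := min_le_left (1 / 4) (r / 2)
    have h6 := min_le_right (1 / 4) (r / 2)
    exact ⟨ρ, h4, by linarith, by linarith, h1, h2⟩
  have key : ∀ Ω₁ Ω₂ : Set E2, IsOpen Ω₁ → IsOpen Ω₂ → Ω₁.Nonempty → Ω₂.Nonempty →
        Ω₁ ⊆ ball (0 : E2) R → Ω₂ ⊆ ball (0 : E2) R →
        IsC1alphaDomain r L α Ω₁ → IsC1alphaDomain r L α Ω₂ →
        (μH[1] (frontier Ω₁)).toReal - (μH[1] (frontier Ω₂)).toReal ≤
          (2 * K * M + M / (ρ₀ ^ 2) ^ β) * hausdorffDist (frontier Ω₁) (frontier Ω₂) ^ β := by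
    intro Ω₁ Ω₂ o1 o2 n1 n2 s1 s2 d1 d2
    obtain ⟨f1, b1⟩ := frontier_ok R Ω₁ n1 s1
    obtain ⟨f2, b2⟩ := frontier_ok R Ω₂ n2 s2
    have hfin := hausdorffEDist_ne_top_of_nonempty_of_bounded f1 f2 b1 b2
    have m1 := hMb Ω₁ o1 s1 d1
    have m2 := hMb Ω₂ o2 s2 d2
    have t1 := (m1.trans_lt ENNReal.ofReal_lt_top).ne
    have t2 := (m2.trans_lt ENNReal.ofReal_lt_top).ne
    have r1 : (μH[1] (frontier Ω₁)).toReal ≤ M := ENNReal.toReal_le_of_le_ofReal hM.le m1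
    have r2 : (μH[1] (frontier Ω₂)).toReal ≤ M := ENNReal.toReal_le_of_le_ofReal hM.le m2
    have p1 : 0 ≤ (μH[1] (frontier Ω₁)).toReal := ENNReal.toReal_nonneg
    have p2 : 0 ≤ (μH[1] (frontier Ω₂)).toReal := ENNReal.toReal_nonneg
    have hh0 : 0 ≤ hausdorffDist (frontier Ω₁) (frontier Ω₂) := hausdorffDist_nonneg
    rcases hh0.eq_or_lt with h0 | hpos
    · rw [(isClosed_frontier.hausdorffDist_zero_iff_eq isClosed_frontier hfin).1 h0.symm, sub_self]
      have := hausdorffDist_nonneg (s := frontier Ω₂) (t := frontier Ω₂)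
      positivity
    have hlt : hausdorffDist (frontier Ω₁) (frontier Ω₂) <
      2 * hausdorffDist (frontier Ω₁) (frontier Ω₂) := by linarith
    have q1 : ∀ x ∈ frontier Ω₁, ∃ y ∈ frontier Ω₂, dist x y <
        2 * hausdorffDist (frontier Ω₁) (frontier Ω₂) := fun x hx =>
      exists_dist_lt_of_hausdorffDist_lt hx hlt hfin
    have q2 : ∀ y ∈ frontier Ω₂, ∃ x ∈ frontier Ω₁, dist y x <
        2 * hausdorffDist (frontier Ω₁) (frontier Ω₂) := fun y hy => by
      obtain ⟨x, hx, hxy⟩ := exists_dist_lt_of_hausdorffDist_lt' hy hlt hfin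
      exact ⟨x, hx, by first | exact hxy | (rw [dist_comm]; exact hxy)⟩
    generalize hausdorffDist (frontier Ω₁) (frontier Ω₂) = h at *
    by_cases hsm : h ≤ ρ₀ ^ 2
    · set ρ := √h with hρd
      have hρ : 0 < ρ := Real.sqrt_pos.2 hpos
      have hρ2 : ρ ^ 2 = h := Real.sq_sqrt hpos.le
      have hρρ : ρ ≤ ρ₀ := Real.sqrt_le_iff.2 ⟨hρ₀.le, hsm⟩
      have hL2 : L * (2 * ρ) ^ α ≤ 1 := le_trans (by gcongr) hC
      have hK2 : K * ρ ^ α ≤ 1 := le_trans (by gcongr) hD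
      have hdc := double_count (frontier Ω₁) (frontier Ω₂) isClosed_frontier isClosed_frontier
        t1 t2 ρ (2 * ρ * (1 - K * ρ ^ α)) (2 * ρ * (1 + K * ρ ^ α))
        (mul_nonneg (by positivity) (by linarith)) (by positivity)
        (fun x hx => (density_near r L α hL hα hα1 Ω₂ o2 d2 ρ (2 * h) hρ (by positivity)
          (by rw [hρ2]) (by linarith) (by linarith) hL2 x (q1 x hx)).2)
        (fun x hx => (density_near r L α hL hα hα1 Ω₁ o1 d1 ρ (2 * h) hρ (by positivity)
          (by rw [hρ2]) (by linarith) (by linarith) hL2 x (q2 x hx)).1)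
      have hα2 : ρ ^ α = h ^ (α / 2) := by
        rw [hρd, Real.sqrt_eq_rpow, ← Real.rpow_mul hpos.le]; congr 1; ring
      have hle : ρ ^ α ≤ h ^ β := by
        rw [hα2]
        exact Real.rpow_le_rpow_of_exponent_ge hpos (by nlinarith) hβα
      have hdc' : (1 - K * ρ ^ α) * (μH[1] (frontier Ω₁)).toReal ≤
          (1 + K * ρ ^ α) * (μH[1] (frontier Ω₂)).toReal := by
        have : 0 < 2 * ρ := by positivity
        refine le_of_mul_le_mul_left ?_ this
        rw [← mul_assoc, ← mul_assoc]
        exact hdc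
      have hsum : K * ρ ^ α * ((μH[1] (frontier Ω₁)).toReal + (μH[1] (frontier Ω₂)).toReal) ≤
          K * h ^ β * (2 * M) := by
        gcongr; linarith
      have hx : 0 ≤ M / (ρ₀ ^ 2) ^ β * h ^ β := by positivity
      linarith
    · have : (ρ₀ ^ 2) ^ β ≤ h ^ β := by
        apply Real.rpow_le_rpow (by positivity) (not_le.1 hsm).le hβ0.le
      have hx : M ≤ M / (ρ₀ ^ 2) ^ β * h ^ β := by
        rw [div_mul_eq_mul_div, le_div_iff₀ (by positivity)]
        gcongr
      have hy : 0 ≤ 2 * K * M * h ^ β := by positivity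
      linarith
  refine ⟨2 * K * M + M / (ρ₀ ^ 2) ^ β, by positivity, ?_⟩
  intro Ω₁ Ω₂ o1 o2 n1 n2 s1 s2 d1 d2
  refine abs_sub_le_iff.2 ⟨key Ω₁ Ω₂ o1 o2 n1 n2 s1 s2 d1 d2, ?_⟩
  rw [hausdorffDist_comm]
  exact key Ω₂ Ω₁ o2 o1 n2 n1 s2 s1 d2 d1
end
end

section
/- Fix L > 0 and let δ₁, δ₂, m₁ ∈ (0,1] be the constants depending on L only from the local graph description of Lipschitz sets. Fix δ with 0 < δ ≤ δ₂/4. Then there exist constants R₀ ≥ 1, h̃ with 0 < h̃ ≤ 1/24, and a₁ > 0, depending on L and δ only, such that for every bounded open set D ⊂ ℝ² which is Lipschitz with constants R₀ and L, setting v = χ_D ∗ G with G the standard Gaussian, the following hold: (i) for every x ∈ ℝ², if h̃ < v(x) < 1 − h̃ then dist(x, ∂D) ≤ m₁ δ R₀; (ii) for every x ∈ ∂D, in the local coordinate system at x (in which D ∩ B_{R₀}(x) = {y₂ < φ(y₁)} for a Lipschitz graph φ with constant at most L, φ(0)=0), for every y with |y₁| ≤ δ₁ R₀ and φ(y₁)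 − δR₀ ≤ y₂ ≤ φ(y₁) + δR₀ one has ∇v(y)·(−e₂) ≥ a₁, where e₂ is the second coordinate vector of the local coordinates. -/
open MeasureTheory Metric Set

noncomputable section

/-- A bounded open set `Ω ⊆ ℝ²` is Lipschitz with constants `r` and `L`. -/
def IsLipDomain (r L : ℝ) (Ω : Set E2) : Prop :=
  ∀ x ∈ frontier Ω, ∃ (A : E2 ≃ᵢ E2) (φ : ℝ → ℝ),
    A x = 0 ∧ LipschitzWith (Real.toNNReal L) φ ∧ φ 0 = 0 ∧
    ∀ y ∈ ball x r, (y ∈ Ω ↔ (A y) 1 < φ ((A y) 0))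

/-- The standard Gaussian on the plane, `G x = (2π)⁻¹ exp (-|x|²/2)`. -/
def Gauss : E2 → ℝ := fun x => (2 * Real.pi)⁻¹ * Real.exp (-‖x‖ ^ 2 / 2)

/-- The convolution `χ_D ∗ G` of the characteristic function of `D` with the Gaussian. -/
def convGauss (D : Set E2) (x : E2) : ℝ :=
  ∫ y, D.indicator (fun _ => (1 : ℝ)) y * Gauss (x - y)

lemma int_exp (b : ℝ) (hb : 0 < b) : ∫ v : E2, Real.exp (-b * ‖v‖ ^ 2) = Real.pi / b := by
  rw [GaussianFourier.integral_rexp_neg_mul_sq_norm hb]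
  simp

lemma integrable_exp2 (b : ℝ) (hb : 0 < b) :
    Integrable (fun v : E2 => Real.exp (-b * ‖v‖ ^ 2)) := by
  apply Integrable.of_integral_ne_zero
  rw [int_exp b hb]
  positivity

lemma gauss_cont : Continuous Gauss := by
  unfold Gauss
  fun_prop

lemma gauss_pos (x : E2) : 0 < Gauss x := by
  unfold Gauss
  positivity

lemma gauss_eq : Gauss = fun x : E2 => (2 * Real.pi)⁻¹ * Real.exp (-(1/2) * ‖x‖ ^ 2) := by
  funext x
  unfold Gauss
  congr 2
  ring

lemma gauss_integrable : Integrable Gauss := by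
  rw [gauss_eq]
  exact (integrable_exp2 _ (by norm_num)).const_mul _

lemma gauss_integral : ∫ x, Gauss x = 1 := by
  rw [gauss_eq, integral_const_mul, int_exp _ (by norm_num)]
  field_simp

lemma conv_integrable (s : Set E2) (hs : MeasurableSet s) (x : E2) :
    Integrable (fun y => s.indicator (fun _ => (1 : ℝ)) y * Gauss (x - y)) := by
  have h := (gauss_integrable.comp_sub_left x).indicator hs
  refine h.congr (Filter.Eventually.of_forall fun y => ?_)
  by_cases hy : y ∈ s <;> simp [hy]

lemma conv_far (s : Set E2) (hs : MeasurableSet s) (x : E2) (ρ : ℝ) (hρ : 0 ≤ ρ)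
    (h : Disjoint (ball x ρ) s) : convGauss s x ≤ 2 * Real.exp (-ρ ^ 2 / 4) := by
  have key : ∀ y, s.indicator (fun _ => (1 : ℝ)) y * Gauss (x - y) ≤
      ((2 * Real.pi)⁻¹ * Real.exp (-ρ ^ 2 / 4)) * Real.exp (-(1/4) * ‖x - y‖ ^ 2) := by
    intro y
    by_cases hy : y ∈ s
    · have : ρ ≤ ‖x - y‖ := by
        by_contra hc
        push Not at hc
        refine Set.disjoint_left.mp h ?_ hy
        rw [mem_ball, dist_comm, dist_eq_norm]
        exact hc
      simp only [hy, indicator_of_mem, one_mul]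
      unfold Gauss
      rw [mul_assoc, ← Real.exp_add]
      gcongr
      nlinarith
    · simp only [hy, not_false_eq_true, indicator_of_notMem, zero_mul]
      positivity
  have hi : Integrable (fun y : E2 => Real.exp (-(1/4) * ‖x - y‖ ^ 2)) :=
    (integrable_exp2 (1/4) (by norm_num)).comp_sub_left x
  unfold convGauss
  refine (integral_mono (conv_integrable s hs x) (hi.const_mul _) key).trans ?_
  rw [integral_const_mul, integral_sub_left_eq_self (fun u : E2 => Real.exp (-(1/4) * ‖u‖ ^ 2)),
    int_exp _ (by norm_num)]
  apply le_of_eq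
  field_simp
  norm_num

lemma conv_compl (s : Set E2) (hs : MeasurableSet s) (x : E2) :
    convGauss s x + convGauss sᶜ x = 1 := by
  unfold convGauss
  rw [← integral_add (conv_integrable s hs x) (conv_integrable _ hs.compl x)]
  refine Eq.trans ?_ ((integral_sub_left_eq_self Gauss volume x).trans gauss_integral)
  congr 1
  funext y
  by_cases hy : y ∈ s <;> simp [hy]

lemma part_one (D : Set E2) (hD : IsOpen D) (ρ h : ℝ) (hρ : 0 ≤ ρ)
    (hh : 2 * Real.exp (-ρ ^ 2 / 4) ≤ h) (x : E2) (h1 : h < convGauss D x)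
    (h2 : convGauss D x < 1 - h) : Metric.infDist x (frontier D) ≤ ρ := by
  by_contra hc
  push Not at hc
  have hb : ball x ρ ⊆ D ∪ (closure D)ᶜ := by
    intro z hz
    by_contra hz'
    simp only [mem_union, mem_compl_iff, not_or, not_not] at hz'
    have hf : z ∈ frontier D := by
      rw [hD.frontier_eq]
      exact ⟨hz'.2, hz'.1⟩
    have := infDist_le_dist_of_mem (x := x) hf
    rw [mem_ball, dist_comm] at hz
    linarith
  have hdis : Disjoint D (closure D)ᶜ :=
    Set.disjoint_compl_right_iff_subset.mpr subset_closure
  rcases (convex_ball x ρ).isPreconnected.subset_or_subset hD isClosed_closure.isOpen_compl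
    hdis hb with hs | hs
  · have := conv_far Dᶜ hD.measurableSet.compl x ρ hρ
      (Set.disjoint_compl_right_iff_subset.mpr hs)
    have := conv_compl D hD.measurableSet x
    linarith
  · have := conv_far D hD.measurableSet x ρ hρ (hdis.symm.mono_left hs)
    linarith

lemma gauss_fderiv (x : E2) : HasFDerivAt Gauss (-(Gauss x) • innerSL ℝ x) x := by
  have h1 : HasFDerivAt (fun x : E2 => ‖x‖ ^ 2) (2 • innerSL ℝ x) x := by
    simpa using (hasStrictFDerivAt_norm_sq x).hasFDerivAt
  have h2 := ((h1.const_mul (-1/2 : ℝ)).exp).const_mul ((2 * Real.pi)⁻¹)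
  have e : Gauss = fun x : E2 => (2 * Real.pi)⁻¹ * Real.exp (-1/2 * ‖x‖ ^ 2) := by
    rw [gauss_eq]; funext x; norm_num
  rw [e]
  refine h2.congr_fderiv ?_
  ext v
  simp
  ring

lemma gauss_mul_norm (x : E2) : Gauss x * ‖x‖ ≤ 1 := by
  unfold Gauss
  have h1 : ‖x‖ ≤ Real.exp (‖x‖ ^ 2 / 2) := by
    have := Real.add_one_le_exp (‖x‖ ^ 2 / 2)
    nlinarith [sq_nonneg (‖x‖ - 1)]
  have h2 : (2 * Real.pi)⁻¹ ≤ 1 := inv_le_one_of_one_le₀ (by nlinarith [Real.pi_gt_three])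
  have h3 : Real.exp (-‖x‖ ^ 2 / 2) * ‖x‖ ≤ 1 := by
    rw [neg_div, Real.exp_neg, inv_mul_le_iff₀ (Real.exp_pos _)]
    simpa using h1
  calc _ = (2 * Real.pi)⁻¹ * (Real.exp (-‖x‖ ^ 2 / 2) * ‖x‖) := by ring
    _ ≤ 1 * 1 := by gcongr
    _ = 1 := by ring

lemma fderiv_conv (D : Set E2) (hD : IsOpen D) (hB : Bornology.IsBounded D) (y w : E2) :
    fderiv ℝ (convGauss D) y w =
      ∫ z, D.indicator (fun _ => (1 : ℝ)) z * (-(Gauss (y - z)) * inner ℝ (y - z) w) := by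
  set F' : E2 → E2 → (E2 →L[ℝ] ℝ) := fun x z =>
    D.indicator (fun _ => (1 : ℝ)) z • (-(Gauss (x - z)) • innerSL ℝ (x - z)) with hF'
  have hind : Measurable (D.indicator (fun _ => (1 : ℝ))) :=
    measurable_const.indicator hD.measurableSet
  have hmeas : AEStronglyMeasurable (F' y) := by
    refine AEStronglyMeasurable.smul hind.aestronglyMeasurable ?_
    apply Continuous.aestronglyMeasurable
    have := gauss_cont
    fun_prop
  have hbd : Integrable (D.indicator (fun _ => (1 : ℝ))) := by
    rw [integrable_indicator_iff hD.measurableSet]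
    exact integrableOn_const hB.measure_lt_top.ne
  have hle : ∀ x z, ‖F' x z‖ ≤ D.indicator (fun _ => (1 : ℝ)) z := by
    intro x z
    by_cases hz : z ∈ D
    · simp only [hF', hz, indicator_of_mem, one_smul, norm_smul, innerSL_apply_norm, norm_neg,
        Real.norm_eq_abs, abs_of_pos (gauss_pos _)]
      exact gauss_mul_norm _
    · simp [hF', hz]
  have h := hasFDerivAt_integral_of_dominated_of_fderiv_le (𝕜 := ℝ) (μ := volume)
    (F := fun x z => D.indicator (fun _ => (1 : ℝ)) z * Gauss (x - z)) (F' := F') (x₀ := y)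
    (bound := D.indicator (fun _ => (1 : ℝ))) (s := univ) Filter.univ_mem
    (Filter.Eventually.of_forall fun x => (conv_integrable D hD.measurableSet x).1)
    (conv_integrable D hD.measurableSet y) hmeas
    (Filter.Eventually.of_forall fun z x _ => hle x z) hbd
    (Filter.Eventually.of_forall fun z x _ => by
      have h1 : HasFDerivAt (fun x => Gauss (x - z)) (-(Gauss (x - z)) • innerSL ℝ (x - z)) x :=
        HasFDerivAt.comp (g := Gauss) (f := fun x => x - z) x (gauss_fderiv (x - z))
          ((hasFDerivAt_id x).sub_const z)
      exact h1.const_mul _)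
  have hF'i : Integrable (F' y) :=
    hbd.mono' hmeas (Filter.Eventually.of_forall fun z => hle y z)
  have h' : HasFDerivAt (convGauss D) (∫ z, F' y z) y := h
  rw [h'.fderiv, ContinuousLinearMap.integral_apply hF'i]
  simp [hF', inner_sub_left]

lemma inner_int (t : ℝ) :
    ∫ b in Iio t, -b * Real.exp (-(1/2) * b ^ 2) = Real.exp (-(1/2) * t ^ 2) := by
  rw [← integral_Iic_eq_integral_Iio]
  have h := integral_Iic_of_hasDerivAt_of_tendsto' (a := t) (m := 0)
    (f := fun b : ℝ => Real.exp (-(1/2) * b ^ 2)) (f' := fun b => -b * Real.exp (-(1/2) * b ^ 2))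
    (fun b _ => by
      have := (((hasDerivAt_id b).pow 2).const_mul (-(1/2) : ℝ)).exp
      refine this.congr_deriv ?_
      simp
      ring)
    (by
      have := (integrable_mul_exp_neg_mul_sq (b := 1/2) (by norm_num)).neg
      refine (this.congr (Filter.Eventually.of_forall fun b => ?_)).integrableOn
      simp)
    (by
      refine Real.tendsto_exp_atBot.comp ?_
      refine Filter.Tendsto.const_mul_atTop_of_neg (by norm_num) ?_
      exact Filter.Tendsto.comp (Filter.tendsto_pow_atTop two_ne_zero)
          Filter.tendsto_abs_atBot_atTop |>.congr (fun b => by simp))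
  simpa using h

lemma main_prod (ψ : ℝ → ℝ) (hψ : Continuous ψ) (K : ℝ)
    (hK : ∀ a, |a| ≤ 1 → |ψ a| ≤ K) :
    Real.pi⁻¹ * Real.exp (-(1/2)) * Real.exp (-K ^ 2 / 2) ≤
      ∫ U : E2, {U : E2 | U 1 < ψ (U 0)}.indicator (fun _ => (1 : ℝ)) U * (-(U 1) * Gauss U) := by
  set S : Set (ℝ × ℝ) := {p | p.2 < ψ p.1} with hSdef
  have hS : MeasurableSet S :=
    (isOpen_lt continuous_snd (hψ.comp continuous_fst)).measurableSet
  set g : ℝ × ℝ → ℝ := S.indicator (fun p => ((2 * Real.pi)⁻¹ * Real.exp (-(1/2) * p.1 ^ 2)) *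
    (-p.2 * Real.exp (-(1/2) * p.2 ^ 2))) with hg
  have hmp : MeasurePreserving (fun U : E2 => MeasurableEquiv.finTwoArrow (α := ℝ)
      ((MeasurableEquiv.toLp 2 (Fin 2 → ℝ)).symm U)) volume volume :=
    (volume_preserving_finTwoArrow ℝ).comp
      (EuclideanSpace.volume_preserving_symm_measurableEquiv_toLp (Fin 2))
  have hemb : MeasurableEmbedding (fun U : E2 => MeasurableEquiv.finTwoArrow (α := ℝ)
      ((MeasurableEquiv.toLp 2 (Fin 2 → ℝ)).symm U)) :=
    (MeasurableEquiv.finTwoArrow (α := ℝ)).measurableEmbedding.comp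
      (MeasurableEquiv.toLp 2 (Fin 2 → ℝ)).symm.measurableEmbedding
  have e1 : ∫ U : E2, {U : E2 | U 1 < ψ (U 0)}.indicator (fun _ => (1 : ℝ)) U *
      (-(U 1) * Gauss U) = ∫ p, g p := by
    rw [← hmp.integral_comp hemb]
    congr 1
    funext U
    have hU : (MeasurableEquiv.finTwoArrow (α := ℝ)
      ((MeasurableEquiv.toLp 2 (Fin 2 → ℝ)).symm U)) = (U 0, U 1) := rfl
    rw [hU]
    have hG : Gauss U = (2 * Real.pi)⁻¹ * Real.exp (-(1/2) * U 0 ^ 2) *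
        Real.exp (-(1/2) * U 1 ^ 2) := by
      unfold Gauss
      rw [EuclideanSpace.norm_sq_eq, mul_assoc, ← Real.exp_add]
      congr 2
      simp [Fin.sum_univ_two]
      ring
    by_cases hu : U 1 < ψ (U 0)
    · have h1 : U ∈ {U : E2 | U 1 < ψ (U 0)} := hu
      have h2 : (U 0, U 1) ∈ S := hu
      rw [hg, indicator_of_mem h1, indicator_of_mem h2, hG]
      ring
    · have h1 : U ∉ {U : E2 | U 1 < ψ (U 0)} := hu
      have h2 : (U 0, U 1) ∉ S := hu
      rw [hg, indicator_of_notMem h1, indicator_of_notMem h2]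
      ring
  have hgi : Integrable g := by
    refine Integrable.indicator ?_ hS
    refine Integrable.mul_prod (f := fun a : ℝ => (2 * Real.pi)⁻¹ * Real.exp (-(1/2) * a ^ 2))
      (g := fun b : ℝ => -b * Real.exp (-(1/2) * b ^ 2)) ?_ ?_
    · exact (integrable_exp_neg_mul_sq (by norm_num)).const_mul _
    · have := (integrable_mul_exp_neg_mul_sq (b := 1/2) (by norm_num)).neg
      refine (this.congr (Filter.Eventually.of_forall fun b => ?_))
      simp
  have hin : ∀ a, ∫ b, g (a, b) =
      (2 * Real.pi)⁻¹ * Real.exp (-(1/2) * a ^ 2) * Real.exp (-(1/2) * ψ a ^ 2) := by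
    intro a
    rw [← inner_int (ψ a), ← integral_const_mul, ← integral_indicator measurableSet_Iio]
    rfl
  have hgo : Integrable (fun a => ∫ b, g (a, b)) := by
    have : Integrable g (volume.prod volume) := hgi
    exact this.integral_prod_left
  rw [e1]
  have e2 : ∫ p, g p = ∫ a, ∫ b, g (a, b) := integral_prod g hgi
  rw [e2]
  set c := (2 * Real.pi)⁻¹ * Real.exp (-(1/2)) * Real.exp (-K ^ 2 / 2) with hc
  have e3 : ∫ a : ℝ, (Icc (-1 : ℝ) 1).indicator (fun _ => c) a = 2 * c := by
    rw [integral_indicator measurableSet_Icc]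
    simp
    norm_num
  have e4 : Real.pi⁻¹ * Real.exp (-(1/2)) * Real.exp (-K ^ 2 / 2) = 2 * c := by
    rw [hc]; field_simp
  rw [e4, ← e3]
  refine integral_mono ?_ hgo ?_
  · rw [integrable_indicator_iff measurableSet_Icc]
    exact integrableOn_const (by simp)
  · intro a
    simp only [hin]
    by_cases ha : a ∈ Icc (-1 : ℝ) 1
    · rw [indicator_of_mem ha, hc]
      have ha' : |a| ≤ 1 := abs_le.mpr ha
      have h1 : a ^ 2 ≤ 1 := by rw [← sq_abs]; nlinarith [abs_nonneg a]
      have h2 : ψ a ^ 2 ≤ K ^ 2 := sq_le_sq' (abs_le.mp (hK a ha')).1 (abs_le.mp (hK a ha')).2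
      gcongr
      · linarith
      · linarith
    · rw [indicator_of_notMem ha]
      positivity

lemma kernel_integrable (S : Set E2) (hS : MeasurableSet S) :
    Integrable (fun U : E2 => S.indicator (fun _ => (1 : ℝ)) U * (-(U 1) * Gauss U)) := by
  have h0 : Integrable (fun U : E2 => -(U 1) * Gauss U) := by
    refine ((integrable_exp2 (1/4) (by norm_num)).const_mul 4).mono' ?_ ?_
    · apply Continuous.aestronglyMeasurable
      have := gauss_cont
      fun_prop
    · refine Filter.Eventually.of_forall fun U => ?_
      have h1 : |U 1| ≤ ‖U‖ := by simpa using PiLp.norm_apply_le U 1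
      have h2 : ‖U‖ ≤ 4 * Real.exp ((1/4) * ‖U‖ ^ 2) := by
        have := Real.add_one_le_exp ((1/4) * ‖U‖ ^ 2)
        nlinarith [sq_nonneg (‖U‖ - 1)]
      have h3 : Gauss U ≤ Real.exp (-(1/2) * ‖U‖ ^ 2) := by
        rw [gauss_eq]
        have : (2 * Real.pi)⁻¹ ≤ 1 := inv_le_one_of_one_le₀ (by nlinarith [Real.pi_gt_three])
        exact mul_le_of_le_one_left (Real.exp_pos _).le this
      rw [norm_mul, norm_neg, Real.norm_eq_abs, Real.norm_eq_abs, abs_of_pos (gauss_pos U)]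
      calc |U 1| * Gauss U ≤ (4 * Real.exp ((1/4) * ‖U‖ ^ 2)) * Real.exp (-(1/2) * ‖U‖ ^ 2) := by
            gcongr
            · exact (gauss_pos U).le
            · exact h1.trans h2
        _ = 4 * Real.exp (-(1/4) * ‖U‖ ^ 2) := by
            rw [mul_assoc, ← Real.exp_add]; congr 2; ring
  refine (h0.indicator hS).congr (Filter.Eventually.of_forall fun y => ?_)
  by_cases hy : y ∈ S <;> simp [hy]

lemma kernel_err (S T : Set E2) (hS : MeasurableSet S) (hT : MeasurableSet T) (R : ℝ) (hR : 0 ≤ R)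
    (h : ∀ U : E2, ‖U‖ < R / 2 → (U ∈ S ↔ U ∈ T)) :
    (∫ U : E2, S.indicator (fun _ => (1 : ℝ)) U * (-(U 1) * Gauss U)) - 16 * Real.exp (-R ^ 2 / 16)
    ≤ ∫ U : E2, T.indicator (fun _ => (1 : ℝ)) U * (-(U 1) * Gauss U) := by
  have hE : Integrable (fun U : E2 => ((2 * Real.pi)⁻¹ * 4 * Real.exp (-R ^ 2 / 16)) *
      Real.exp (-(1/8) * ‖U‖ ^ 2)) := (integrable_exp2 (1/8) (by norm_num)).const_mul _
  have hEi : ∫ U : E2, ((2 * Real.pi)⁻¹ * 4 * Real.exp (-R ^ 2 / 16)) *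
      Real.exp (-(1/8) * ‖U‖ ^ 2) = 16 * Real.exp (-R ^ 2 / 16) := by
    rw [integral_const_mul, int_exp _ (by norm_num)]
    field_simp
    norm_num
  rw [← hEi, ← integral_sub (kernel_integrable S hS) hE]
  refine integral_mono ((kernel_integrable S hS).sub hE) (kernel_integrable T hT) ?_
  intro U
  simp only
  by_cases hU : ‖U‖ < R / 2
  · have : S.indicator (fun _ => (1 : ℝ)) U = T.indicator (fun _ => (1 : ℝ)) U := by
      by_cases hs : U ∈ S
      · simp [hs, (h U hU).mp hs]
      · simp [hs, mt (h U hU).mpr hs]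
    rw [this]
    have : 0 ≤ ((2 * Real.pi)⁻¹ * 4 * Real.exp (-R ^ 2 / 16)) *
      Real.exp (-(1/8) * ‖U‖ ^ 2) := by positivity
    linarith
  · push Not at hU
    have h1 : |U 1| ≤ ‖U‖ := by simpa using PiLp.norm_apply_le U 1
    have h2 : ‖U‖ ≤ 4 * Real.exp ((1/8) * ‖U‖ ^ 2) := by
      have := Real.add_one_le_exp ((1/8) * ‖U‖ ^ 2)
      nlinarith [sq_nonneg (‖U‖ - 1)]
    have h3 : |-(U 1) * Gauss U| ≤ ((2 * Real.pi)⁻¹ * 4 * Real.exp (-R ^ 2 / 16)) *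
        Real.exp (-(1/8) * ‖U‖ ^ 2) := by
      rw [abs_mul, abs_neg, abs_of_pos (gauss_pos U)]
      calc |U 1| * Gauss U ≤ (4 * Real.exp ((1/8) * ‖U‖ ^ 2)) * Gauss U := by
            gcongr
            · exact (gauss_pos U).le
            · exact h1.trans h2
        _ = (2 * Real.pi)⁻¹ * 4 *
            (Real.exp ((1/8) * ‖U‖ ^ 2) * Real.exp (-(1/2) * ‖U‖ ^ 2)) := by
            rw [gauss_eq]; ring
        _ ≤ (2 * Real.pi)⁻¹ * 4 * (Real.exp (-R ^ 2 / 16) * Real.exp (-(1/8) * ‖U‖ ^ 2)) := by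
            rw [← Real.exp_add, ← Real.exp_add]
            refine mul_le_mul_of_nonneg_left (Real.exp_le_exp.mpr ?_) (by positivity)
            nlinarith
        _ = _ := by ring
    have h4 := abs_le.mp h3
    by_cases hs : U ∈ S <;> by_cases ht : U ∈ T <;> simp only [hs, ht, indicator_of_mem,
      indicator_of_notMem, not_false_eq_true, one_mul, zero_mul] <;> linarith

lemma part_two (L : ℝ) (hL : 0 < L) (δ₁ δ R : ℝ) (hR : 0 ≤ R) (hδ : 0 ≤ δ)
    (hgeom : δ₁ * (1 + L) + δ ≤ 1 / 2) (hδ16 : δ ≤ 1 / 16)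
    (D : Set E2) (hD : IsOpen D) (hB : Bornology.IsBounded D) (x : E2)
    (A : E2 ≃ᵢ E2) (φ : ℝ → ℝ) (hAx : A x = 0) (hφ : LipschitzWith (Real.toNNReal L) φ)
    (hφ0 : φ 0 = 0) (hloc : ∀ y ∈ ball x R, (y ∈ D ↔ (A y) 1 < φ ((A y) 0)))
    (y : E2) (hy0 : |(A y) 0| ≤ δ₁ * R) (hy1 : φ ((A y) 0) - δ * R ≤ (A y) 1)
    (hy2 : (A y) 1 ≤ φ ((A y) 0) + δ * R) :
    Real.pi⁻¹ * Real.exp (-(1/2)) * Real.exp (-(R / 16 + L) ^ 2 / 2) - 16 * Real.exp (-R ^ 2 / 16)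
      ≤ fderiv ℝ (convGauss D) y
        (A.symm (A y - EuclideanSpace.single (1 : Fin 2) (1 : ℝ)) - y) := by
  have hlip : ∀ s t, |φ s - φ t| ≤ L * |s - t| := by
    intro s t
    have := hφ.dist_le_mul s t
    rwa [Real.dist_eq, Real.dist_eq, Real.coe_toNNReal _ hL.le] at this
  set B := A.toRealLinearIsometryEquiv with hBdef
  have hAB : ∀ U, A (y + B.symm U) = A y + U := by
    intro U
    have h1 := A.toRealLinearIsometryEquiv_apply (y + B.symm U)
    have h2 := A.toRealLinearIsometryEquiv_apply y
    rw [← hBdef, map_add, LinearIsometryEquiv.apply_symm_apply] at h1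
    rw [← hBdef] at h2
    rw [h2] at h1
    have : A (y + B.symm U) = (A y - A 0 + U) + A 0 := by rw [h1]; abel
    rw [this]; abel
  set e := EuclideanSpace.single (1 : Fin 2) (1 : ℝ) with he
  have hw : A.symm (A y - e) - y = -B.symm e := by
    have : A.symm (A y - e) = y + B.symm (-e) := by
      rw [IsometryEquiv.symm_apply_eq, hAB]; abel
    rw [this, map_neg]; abel
  rw [hw, fderiv_conv D hD hB]
  set T : Set E2 := {U | y + B.symm U ∈ D} with hT
  have hTm : MeasurableSet T :=
    (hD.preimage (f := fun U => y + B.symm U) (by fun_prop)).measurableSet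
  have hcv : ∫ z, D.indicator (fun _ => (1 : ℝ)) z *
      (-(Gauss (y - z)) * inner ℝ (y - z) (-B.symm e)) =
      ∫ U : E2, T.indicator (fun _ => (1 : ℝ)) U * (-(U 1) * Gauss U) := by
    rw [← integral_add_left_eq_self _ y,
      ← B.symm.measurePreserving.integral_comp B.symm.toHomeomorph.measurableEmbedding]
    congr 1
    funext U
    have hG : Gauss (-B.symm U) = Gauss U := by simp [Gauss]
    have hI : inner ℝ (-B.symm U) (-B.symm e) = U 1 := by
      rw [inner_neg_neg, LinearIsometryEquiv.inner_map_map, he]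
      simp [EuclideanSpace.inner_single_right]
    have hs : y - (y + B.symm U) = -B.symm U := by abel
    rw [hs, hG, hI]
    have : D.indicator (fun _ => (1 : ℝ)) (y + B.symm U) = T.indicator (fun _ => (1 : ℝ)) U := rfl
    rw [this]
    ring
  rw [hcv]
  set ψ : ℝ → ℝ := fun a => φ ((A y) 0 + a) - (A y) 1 with hψ
  have hψc : Continuous ψ := by
    have := hφ.continuous
    fun_prop
  have hψK : ∀ a, |a| ≤ 1 → |ψ a| ≤ R / 16 + L := by
    intro a ha
    have h1 := hlip ((A y) 0 + a) ((A y) 0)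
    rw [add_sub_cancel_left] at h1
    have h2 : L * |a| ≤ L := by nlinarith
    have h3 : δ * R ≤ R / 16 := by nlinarith
    have h4 := abs_le.mp (h1.trans h2)
    simp only [hψ]
    rw [abs_le]
    constructor <;> linarith [h4.1, h4.2]
  have hm := main_prod ψ hψc _ hψK
  have hnY : ‖A y‖ ≤ R / 2 := by
    have hY1 : |(A y) 1| ≤ L * (δ₁ * R) + δ * R := by
      have h1 := hlip ((A y) 0) 0
      rw [hφ0, sub_zero, sub_zero] at h1
      have h2 : L * |(A y) 0| ≤ L * (δ₁ * R) := by gcongr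
      have h3 := abs_le.mp (h1.trans h2)
      rw [abs_le]
      constructor <;> linarith [h3.1, h3.2]
    have hn : ‖A y‖ ≤ |(A y) 0| + |(A y) 1| := by
      rw [EuclideanSpace.norm_eq, Fin.sum_univ_two]
      apply Real.sqrt_le_iff.mpr
      refine ⟨by positivity, ?_⟩
      simp only [Real.norm_eq_abs]
      nlinarith [mul_nonneg (abs_nonneg ((A y) 0)) (abs_nonneg ((A y) 1))]
    have : (δ₁ * (1 + L) + δ) * R ≤ 1 / 2 * R := by gcongr
    linarith
  have hST : ∀ U : E2, ‖U‖ < R / 2 → (U ∈ {U : E2 | U 1 < ψ (U 0)} ↔ U ∈ T) := by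
    intro U hU
    have hb : y + B.symm U ∈ ball x R := by
      rw [mem_ball, ← A.dist_eq, hAx, hAB, dist_zero_right]
      have := norm_add_le (A y) U
      linarith
    have h1 := hloc _ hb
    rw [hAB] at h1
    simp only [hT, mem_ofPred_eq, h1, hψ, PiLp.add_apply]
    constructor <;> intro h <;> linarith
  have hSm : MeasurableSet {U : E2 | U 1 < ψ (U 0)} :=
    (isOpen_lt (by fun_prop) (by fun_prop)).measurableSet
  have := kernel_err _ T hSm hTm R hR hST
  linarith

/-- Boundary localization for `χ_D ∗ G`: given the geometric constants `δ₁, δ₂, m₁`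
(depending on `L` only, chosen so that the boundary strips `N_δ(x)` fit inside `B_{r/2}(x)`)
and `0 < δ ≤ δ₂/4`, there are `R₀ ≥ 1`, `0 < h̃ ≤ 1/24` and `a₁ > 0`, depending on `L` and `δ`
only, such that for every bounded open `D` Lipschitz with constants `R₀` and `L`:
(i) if `h̃ < (χ_D ∗ G)(x) < 1 - h̃` then `dist (x, ∂D) ≤ m₁ δ R₀`; and
(ii) in every local graph coordinate system at a boundary point, on the strip
`{|y₁| ≤ δ₁ R₀, φ(y₁) - δR₀ ≤ y₂ ≤ φ(y₁) + δR₀}` one has `∇(χ_D ∗ G)(y)·(-e₂) ≥ a₁`. -/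
theorem stmt12 (L : ℝ) (hL : 0 < L)
    (δ₁ δ₂ m₁ : ℝ) (hδ₁ : 0 < δ₁) (hδ₁' : δ₁ ≤ 1 / 2)
    (hδ₂ : 0 < δ₂) (hδ₂' : δ₂ ≤ δ₁) (hm₁ : 0 < m₁) (hm₁' : m₁ ≤ 1)
    (hgeom : δ₁ * (1 + L) + δ₂ ≤ 1 / 2)
    (δ : ℝ) (hδ : 0 < δ) (hδ' : δ ≤ δ₂ / 4) :
    ∃ R₀ htil a₁ : ℝ, 1 ≤ R₀ ∧ 0 < htil ∧ htil ≤ 1 / 24 ∧ 0 < a₁ ∧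
      ∀ D : Set E2, IsOpen D → Bornology.IsBounded D → IsLipDomain R₀ L D →
        (∀ x : E2, htil < convGauss D x → convGauss D x < 1 - htil →
          Metric.infDist x (frontier D) ≤ m₁ * δ * R₀) ∧
        (∀ x ∈ frontier D, ∀ (A : E2 ≃ᵢ E2) (φ : ℝ → ℝ),
          A x = 0 → LipschitzWith (Real.toNNReal L) φ → φ 0 = 0 →
          (∀ y ∈ ball x R₀, (y ∈ D ↔ (A y) 1 < φ ((A y) 0))) →
          ∀ y : E2, |(A y) 0| ≤ δ₁ * R₀ →
            φ ((A y) 0) - δ * R₀ ≤ (A y) 1 → (A y) 1 ≤ φ ((A y) 0) + δ * R₀ →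
            a₁ ≤ fderiv ℝ (convGauss D) y
              (A.symm (A y - EuclideanSpace.single (1 : Fin 2) (1 : ℝ)) - y)) := by
  have hδ16 : δ ≤ 1 / 16 := by nlinarith [mul_pos hδ₁ hL]
  have hgeom' : δ₁ * (1 + L) + δ ≤ 1 / 2 := by linarith
  set κ := m₁ * δ with hκ
  have hκ0 : 0 < κ := by positivity
  set c := Real.pi⁻¹ * Real.exp (-(1/2)) * Real.exp (-L ^ 2) with hc
  have hc0 : 0 < c := by positivity
  have hsq : Filter.Tendsto (fun R : ℝ => R ^ 2) Filter.atTop Filter.atTop :=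
    Filter.tendsto_pow_atTop two_ne_zero
  have t1 : Filter.Tendsto (fun R : ℝ => 2 * Real.exp (-(κ ^ 2 / 4) * R ^ 2)) Filter.atTop
      (nhds (2 * 0)) :=
    (Real.tendsto_exp_atBot.comp
      (hsq.const_mul_atTop_of_neg (by have : 0 < κ ^ 2 := by positivity
                                      linarith))).const_mul 2
  have t2 : Filter.Tendsto (fun R : ℝ => 16 * Real.exp (-(15 / 256) * R ^ 2)) Filter.atTop
      (nhds (16 * 0)) :=
    (Real.tendsto_exp_atBot.comp
      (hsq.const_mul_atTop_of_neg (by norm_num))).const_mul 16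
  rw [mul_zero] at t1 t2
  obtain ⟨R, hR1, hR2, hR3⟩ := ((Filter.eventually_ge_atTop (1 : ℝ)).and
    ((t1.eventually_lt_const (show (0 : ℝ) < 1 / 24 by norm_num)).and
      (t2.eventually_lt_const hc0))).exists
  refine ⟨R, 1 / 24, Real.pi⁻¹ * Real.exp (-(1/2)) * Real.exp (-(R / 16 + L) ^ 2 / 2) -
    16 * Real.exp (-R ^ 2 / 16), hR1, by norm_num, le_rfl, ?_, ?_⟩
  · have h1 : c * Real.exp (-R ^ 2 / 256) ≤
        Real.pi⁻¹ * Real.exp (-(1/2)) * Real.exp (-(R / 16 + L) ^ 2 / 2) := by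
      rw [hc, mul_assoc _ (Real.exp (-L ^ 2)), ← Real.exp_add]
      gcongr
      nlinarith [sq_nonneg (R / 16 - L)]
    have h2 : 16 * Real.exp (-R ^ 2 / 16) =
        16 * Real.exp (-(15 / 256) * R ^ 2) * Real.exp (-R ^ 2 / 256) := by
      rw [mul_assoc, ← Real.exp_add]
      congr 2
      ring
    have h3 := mul_lt_mul_of_pos_right hR3 (Real.exp_pos (-R ^ 2 / 256))
    linarith
  · intro D hD hB _
    refine ⟨fun x h1 h2 => ?_, ?_⟩
    · refine part_one D hD (κ * R) (1 / 24) (by positivity) ?_ x h1 h2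
      have : -(κ * R) ^ 2 / 4 = -(κ ^ 2 / 4) * R ^ 2 := by ring
      rw [this]
      exact hR2.le
    · intro x _ A φ hAx hφ hφ0 hloc y hy0 hy1 hy2
      exact part_two L hL δ₁ δ R (by linarith) hδ.le hgeom' hδ16 D hD hB x A φ hAx hφ hφ0 hloc
        y hy0 hy1 hy2
end
end
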